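/- Let d ≥ 3 be an integer, γ ∈ [1/2, 1), and let η > 0 be a sufficiently small constant depending only on (d,γ). There exists a constant C = C(d, γ, η) such that for all sufficiently large L, all λ ∈ [1, (log L)⁴], and uniformly in g ∈ ℤ, ξ ∈ ℝ, and real u with 0 < u ≤ λL: ∫_{{s ∈ ℝ : L^{−1} ≤ |s| ≤ L^{2γ−2+η/(10d)}}} |G_g(s, ξ, u)|^{2d} ds ≤ C·λ^{2d}·L^{2d−2}·L^{−(d−1)(2−2γ)+η}. -/

import Mathlib

open MeasureTheory
open scoped RealInnerProductSpace ENNReal NNReal BigOperators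

noncomputable section

/-- `e(z) = e^{2πiz}`. -/
def efun (t : ℝ) : ℂ := Complex.exp (2 * (Real.pi : ℂ) * Complex.I * (t : ℂ))

/-- The Gauss sum `G_g(s, r, u) = ∑_{p=g}^{g+⌊u⌋} e(s p² + r p)`. -/
def gaussSumG (g : ℤ) (s r u : ℝ) : ℂ :=
  ∑ j ∈ Finset.range (⌊u⌋₊ + 1), efun (s * ((g : ℝ) + (j : ℝ)) ^ 2 + r * ((g : ℝ) + (j : ℝ)))

/-- The distance from a real number to the nearest integer. -/
def distInt (x : ℝ) : ℝ := |x - round x|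

lemma distInt_nonneg (x : ℝ) : 0 ≤ distInt x := abs_nonneg _

lemma distInt_add_intCast (x : ℝ) (n : ℤ) : distInt (x + n) = distInt x := by
  unfold distInt
  rw [round_add_intCast]
  push_cast
  congr 1
  ring

lemma distInt_le_add (x y : ℝ) : distInt x ≤ distInt (x + y) + |y| := by
  unfold distInt
  calc |x - round x| ≤ |x - round (x + y)| := round_le x _
    _ = |(x + y - round (x + y)) + -y| := by congr 1; ring
    _ ≤ |x + y - round (x + y)| + |-y| := abs_add_le _ _
    _ = _ := by rw [abs_neg]

lemma abs_le_distInt {x : ℝ} (hx : |x| ≤ 1 / 2) : |x| ≤ distInt x := by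
  unfold distInt
  by_cases h : round x = 0
  · simp [h]
  · have h1 : (1 : ℝ) ≤ |(round x : ℝ)| := by exact_mod_cast Int.one_le_abs h
    have h2 := abs_sub_abs_le_abs_sub (round x : ℝ) x
    rw [abs_sub_comm] at h2
    linarith

lemma min_le_distInt {x : ℝ} (h0 : 0 ≤ x) (h1 : x < 1) : min x (1 - x) ≤ distInt x := by
  unfold distInt
  rw [abs_sub_round_eq_min, Int.fract_eq_self.2 ⟨h0, h1⟩]

lemma efun_add (x y : ℝ) : efun (x + y) = efun x * efun y := by
  unfold efun
  rw [← Complex.exp_add]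
  push_cast
  ring_nf

lemma efun_eq (x : ℝ) : efun x = Complex.exp (Complex.I * ((2 * Real.pi * x : ℝ) : ℂ)) := by
  unfold efun
  push_cast
  ring_nf

lemma norm_efun (x : ℝ) : ‖efun x‖ = 1 := by
  rw [efun_eq, mul_comm, Complex.norm_exp_ofReal_mul_I]

lemma efun_intCast (n : ℤ) : efun n = 1 := by
  unfold efun
  rw [Complex.exp_eq_one_iff]
  exact ⟨n, by push_cast; ring⟩

lemma conj_efun (x : ℝ) : (starRingEnd ℂ) (efun x) = efun (-x) := by
  rw [efun_eq, efun_eq, ← Complex.exp_conj, map_mul, Complex.conj_ofReal, Complex.conj_I]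
  push_cast
  ring_nf

lemma efun_nat_mul (k : ℕ) (x : ℝ) : efun (k * x) = efun x ^ k := by
  unfold efun
  rw [← Complex.exp_nat_mul]
  push_cast
  ring_nf

lemma distInt_le_norm_efun_sub_one (x : ℝ) : 4 * distInt x ≤ ‖efun x - 1‖ := by
  have h : efun x = efun (x - round x) := by
    conv_lhs => rw [← sub_add_cancel x (round x : ℝ), efun_add, efun_intCast, mul_one]
  rw [h, efun_eq, Complex.norm_exp_I_mul_ofReal_sub_one, norm_mul]
  have hr := abs_sub_round x
  have hpi := Real.pi_pos
  have h2 : |2 * Real.pi * (x - round x) / 2| = Real.pi * |x - round x| := by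
    rw [show 2 * Real.pi * (x - round x) / 2 = Real.pi * (x - round x) by ring, abs_mul,
      abs_of_pos hpi]
  have h3 := Real.mul_abs_le_abs_sin (x := 2 * Real.pi * (x - round x) / 2) (by
    rw [h2]; nlinarith)
  rw [h2] at h3
  have h4 : 2 / Real.pi * (Real.pi * |x - round x|) = 2 * |x - round x| := by
    field_simp
  rw [h4] at h3
  simp only [Real.norm_eq_abs, Nat.abs_ofNat]
  unfold distInt
  linarith

lemma distInt_mul_norm_geom_sum_le (x : ℝ) (m : ℕ) :
    distInt x * ‖∑ k ∈ Finset.range m, efun (k * x)‖ ≤ 1 := by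
  simp only [efun_nat_mul]
  have h := congrArg norm (mul_geom_sum (efun x) m)
  rw [norm_mul] at h
  have h1 : ‖efun x ^ m - 1‖ ≤ 2 := by
    refine (norm_sub_le _ _).trans ?_
    rw [norm_pow, norm_efun]
    norm_num
  have h2 := distInt_le_norm_efun_sub_one x
  have h3 := norm_nonneg (∑ i ∈ Finset.range m, efun x ^ i)
  nlinarith [mul_le_mul_of_nonneg_right h2 h3]

/-- Expansion of the squared modulus of a finite sum along the differences of the indices. -/
lemma normSq_sum_range_eq (f : ℕ → ℂ) (M : ℕ) :
    Complex.normSq (∑ j ∈ Finset.range M, f j) =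
      ∑ j ∈ Finset.range M, Complex.normSq (f j) +
        2 * (∑ h ∈ Finset.range M, ∑ k ∈ Finset.range (M - (h + 1)),
          f (k + (h + 1)) * (starRingEnd ℂ) (f k)).re := by
  induction M with
  | zero => simp
  | succ M ih =>
    rw [Finset.sum_range_succ, Complex.normSq_add, ih, Finset.sum_range_succ,
      Finset.sum_range_succ _ M]
    have h1 : ∑ h ∈ Finset.range M, ∑ k ∈ Finset.range (M + 1 - (h + 1)),
          f (k + (h + 1)) * (starRingEnd ℂ) (f k) =
        ∑ h ∈ Finset.range M, ∑ k ∈ Finset.range (M - (h + 1)),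
          f (k + (h + 1)) * (starRingEnd ℂ) (f k) +
        f M * (starRingEnd ℂ) (∑ k ∈ Finset.range M, f k) := by
      rw [map_sum, Finset.mul_sum,
        ← Finset.sum_range_reflect (fun k => f M * (starRingEnd ℂ) (f k)), ← Finset.sum_add_distrib]
      refine Finset.sum_congr rfl fun h hh => ?_
      have hh' := Finset.mem_range.1 hh
      rw [show M + 1 - (h + 1) = (M - (h + 1)) + 1 by omega, Finset.sum_range_succ]
      rw [show M - (h + 1) + (h + 1) = M by omega, show M - 1 - h = M - (h + 1) by omega]
    rw [h1]
    have h2 : (f M * (starRingEnd ℂ) (∑ k ∈ Finset.range M, f k)).re =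
        ((∑ k ∈ Finset.range M, f k) * (starRingEnd ℂ) (f M)).re := by
      simp only [Complex.mul_re, Complex.conj_re, Complex.conj_im]
      ring
    simp only [Nat.sub_self, Finset.range_zero, Finset.sum_empty, add_zero, Complex.add_re, h2]
    ring

/-- Weyl differencing for the quadratic Gauss sum. -/
lemma norm_gaussSumG_sq_le (g : ℤ) (s r u : ℝ) :
    ‖gaussSumG g s r u‖ ^ 2 ≤ (⌊u⌋₊ + 1 : ℕ) +
      2 * ∑ h ∈ Finset.range (⌊u⌋₊ + 1),
        ‖∑ k ∈ Finset.range (⌊u⌋₊ + 1 - (h + 1)), efun (k * ((2 * (h + 1) : ℕ) * s))‖ := by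
  rw [← Complex.normSq_eq_norm_sq, gaussSumG, normSq_sum_range_eq]
  generalize ⌊u⌋₊ + 1 = M
  have h1 : ∀ x : ℝ, Complex.normSq (efun x) = 1 := fun x => by
    rw [Complex.normSq_eq_norm_sq, norm_efun, one_pow]
  simp only [h1, Finset.sum_const, Finset.card_range, nsmul_eq_mul, mul_one]
  gcongr
  refine (Complex.re_le_norm _).trans ((norm_sum_le _ _).trans (Finset.sum_le_sum fun h _ => ?_))
  refine le_of_eq ?_
  have h2 : ∀ k : ℕ,
      efun (s * ((g : ℝ) + ((k + (h + 1) : ℕ) : ℝ)) ^ 2 + r * ((g : ℝ) + ((k + (h + 1) : ℕ) : ℝ))) *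
        (starRingEnd ℂ) (efun (s * ((g : ℝ) + (k : ℝ)) ^ 2 + r * ((g : ℝ) + (k : ℝ)))) =
      efun (k * ((2 * (h + 1) : ℕ) * s)) *
        efun (s * (2 * g * (h + 1) + (h + 1) ^ 2) + r * (h + 1)) := fun k => by
    rw [conj_efun, ← efun_add, ← efun_add]
    congr 1
    push_cast
    ring
  simp only [h2]
  rw [← Finset.sum_mul, norm_mul, norm_efun, mul_one]

lemma sum_range_inv_succ_le (n : ℕ) :
    ∑ i ∈ Finset.range n, ((i : ℝ) + 1)⁻¹ ≤ 1 + Real.log n := by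
  have h := harmonic_le_one_add_log n
  unfold harmonic at h
  push_cast at h
  exact h

lemma inv_distInt_div_le {m q : ℕ} (hm : 0 < m) (hq : m < q) :
    (distInt ((m : ℝ) / q))⁻¹ ≤ q * ((m : ℝ)⁻¹ + ((q : ℝ) - m)⁻¹) := by
  have hm' : (0 : ℝ) < m := by exact_mod_cast hm
  have hq' : (m : ℝ) < q := by exact_mod_cast hq
  have hq0 : (0 : ℝ) < q := hm'.trans hq'
  have hs : 0 < (q : ℝ) - m := sub_pos.2 hq'
  have h := min_le_distInt (x := (m : ℝ) / q) (by positivity) ((div_lt_one hq0).2 hq')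
  have h1 : 1 - (m : ℝ) / q = (q - m) / q := by field_simp
  rw [h1] at h
  have hi1 : 0 < (m : ℝ)⁻¹ := inv_pos.2 hm'
  have hi2 : 0 < ((q : ℝ) - m)⁻¹ := inv_pos.2 hs
  rcases min_le_iff.1 h with h | h
  · refine (inv_anti₀ (by positivity) h).trans ?_
    rw [inv_div, div_eq_mul_inv]
    gcongr
    linarith
  · refine (inv_anti₀ (by positivity) h).trans ?_
    rw [inv_div, div_eq_mul_inv]
    gcongr
    linarith

lemma sum_range_inv_distInt_div_le (q : ℕ) :
    ∑ m ∈ Finset.range q, (distInt ((m : ℝ) / q))⁻¹ ≤ 2 * q * (1 + Real.log q) := by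
  rcases q with _ | n
  · simp
  rw [Finset.sum_range_succ']
  have h0 : (distInt (((0 : ℕ) : ℝ) / ((n + 1 : ℕ) : ℝ)))⁻¹ = 0 := by simp [distInt]
  rw [h0, add_zero]
  have h1 : ∑ m ∈ Finset.range n, (distInt (((m + 1 : ℕ) : ℝ) / ((n + 1 : ℕ) : ℝ)))⁻¹ ≤
      ∑ m ∈ Finset.range n, ((n + 1 : ℕ) : ℝ) * (((m : ℝ) + 1)⁻¹ + (((n - 1 - m : ℕ) : ℝ) + 1)⁻¹) := by
    refine Finset.sum_le_sum fun m hm => ?_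
    have hm' := Finset.mem_range.1 hm
    refine (inv_distInt_div_le m.succ_pos (by omega)).trans (le_of_eq ?_)
    have : (((n - 1 - m : ℕ) : ℝ)) = n - 1 - m := by
      rw [Nat.sub_sub, Nat.cast_sub (by omega)]
      push_cast
      ring
    rw [this]
    push_cast
    ring_nf
  refine h1.trans ?_
  rw [← Finset.mul_sum, Finset.sum_add_distrib,
    Finset.sum_range_reflect (fun i => ((i : ℝ) + 1)⁻¹) n]
  have h2 := sum_range_inv_succ_le n
  have h3 : Real.log n ≤ Real.log ((n + 1 : ℕ) : ℝ) := by
    rcases Nat.eq_zero_or_pos n with rfl | hn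
    · simp
    · exact Real.log_le_log (by exact_mod_cast hn) (by push_cast; linarith)
  have h4 : (0 : ℝ) ≤ ((n + 1 : ℕ) : ℝ) := by positivity
  nlinarith

lemma sum_range_mul_zmod (q P : ℕ) [NeZero q] (F : ZMod q → ℝ) :
    ∑ m ∈ Finset.range (q * P), F m = P * ∑ x : ZMod q, F x := by
  induction P with
  | zero => simp
  | succ P ih =>
    rw [Nat.mul_succ, Finset.sum_range_add, ih]
    have h : ∑ m ∈ Finset.range q, F ((q * P + m : ℕ) : ZMod q) = ∑ x : ZMod q, F x := by
      obtain ⟨n, rfl⟩ : ∃ n, q = n + 1 := Nat.exists_eq_succ_of_ne_zero (NeZero.ne q)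
      rw [← Fin.sum_univ_eq_sum_range (fun m => F (((n + 1) * P + m : ℕ) : ZMod (n + 1)))]
      refine Finset.sum_congr rfl fun x _ => ?_
      congr 1
      have := ZMod.natCast_zmod_val (n := n + 1) x
      rw [Nat.cast_add, Nat.cast_mul, ZMod.natCast_self, zero_mul, zero_add]
      exact this
    rw [h]
    push_cast
    ring

lemma sum_range_inv_distInt_mul_div_le (q P : ℕ) (hq : 0 < q) (a : ℤ) (ha : IsCoprime (q : ℤ) a) :
    ∑ m ∈ Finset.range (q * P), (distInt ((m : ℝ) * a / q))⁻¹ ≤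
      P * (2 * q * (1 + Real.log q)) := by
  have : NeZero q := ⟨hq.ne'⟩
  have hq0 : (q : ℝ) ≠ 0 := by exact_mod_cast hq.ne'
  have hperiod : ∀ m : ℤ, distInt ((m : ℝ) / q) = distInt ((((m : ZMod q)).val : ℝ) / q) := by
    intro m
    have h1 : ((((m : ZMod q)).val : ℤ) : ℝ) = ((m % q : ℤ) : ℝ) := by rw [ZMod.val_intCast]
    have h2 : (m : ℝ) = ((m % q : ℤ) : ℝ) + q * ((m / q : ℤ) : ℝ) := by
      exact_mod_cast (Int.emod_add_mul_ediv m q).symm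
    rw [Int.cast_natCast] at h1
    rw [h1, h2, add_div, mul_div_cancel_left₀ _ hq0, distInt_add_intCast]
  obtain ⟨w, hw⟩ := (ZMod.coe_int_isUnit_iff_isCoprime a q).2 ha
  have h1 : ∀ m ∈ Finset.range (q * P), (distInt ((m : ℝ) * a / q))⁻¹ =
      (fun x : ZMod q => (distInt (((w * x).val : ℝ) / q))⁻¹) m := by
    intro m _
    have := hperiod (m * a)
    push_cast at this
    simp only [this, hw, mul_comm (a : ZMod q)]
  rw [Finset.sum_congr rfl h1,
    sum_range_mul_zmod q P (fun x : ZMod q => (distInt (((w * x).val : ℝ) / q))⁻¹)]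
  gcongr
  rw [Fintype.sum_equiv (Units.mulLeft w) (fun x : ZMod q => (distInt (((w * x).val : ℝ) / q))⁻¹)
    (fun x => (distInt ((x.val : ℝ) / q))⁻¹) (fun x => rfl)]
  have h2 := sum_range_mul_zmod q 1 (fun x => (distInt ((x.val : ℝ) / q))⁻¹)
  rw [mul_one, Nat.cast_one, one_mul] at h2
  rw [← h2]
  refine le_trans (le_of_eq ?_) (sum_range_inv_distInt_div_le q)
  refine Finset.sum_congr rfl fun m hm => ?_
  rw [ZMod.val_natCast_of_lt (Finset.mem_range.1 hm)]

/-- Sums over a full range of terms bounded by `min N (distInt (m * s))⁻¹`: the indices not divisible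
by the denominator `q` of a good rational approximation of `s`. -/
lemma sum_not_dvd_le {N q : ℕ} (hN : 0 < N) (hq : 0 < q) (hqN : q ≤ 4 * N) {a : ℤ}
    (ha : IsCoprime (q : ℤ) a) {s : ℝ} (hs : |s - a / q| ≤ 1 / (4 * N * q)) (W : ℕ → ℝ)
    (hW : ∀ m : ℕ, distInt (m * s) * W m ≤ 1) :
    ∑ m ∈ Finset.Icc 1 (2 * N) with ¬ q ∣ m, W m ≤ 24 * N * (1 + Real.log (4 * N)) := by
  have hq0 : (0 : ℝ) < q := by exact_mod_cast hq
  have hN0 : (0 : ℝ) < N := by exact_mod_cast hN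
  have hqN' : (q : ℝ) ≤ 4 * N := by exact_mod_cast hqN
  set P := 2 * N / q + 1 with hP
  have h1 : ∀ m ∈ (Finset.Icc 1 (2 * N)).filter (fun m => ¬ q ∣ m),
      W m ≤ 2 * (distInt ((m : ℝ) * a / q))⁻¹ := by
    intro m hm
    obtain ⟨hm1, hm2⟩ := Finset.mem_filter.1 hm
    have hmN : (m : ℝ) ≤ 2 * N := by exact_mod_cast (Finset.mem_Icc.1 hm1).2
    have hfar : 1 / (q : ℝ) ≤ distInt ((m : ℝ) * a / q) := by
      unfold distInt
      set z := round ((m : ℝ) * a / q)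
      have hne : (m : ℤ) * a - q * z ≠ 0 := by
        intro h0
        have : (q : ℤ) ∣ m * a := ⟨z, by linarith⟩
        exact hm2 (Int.natCast_dvd_natCast.1 (ha.dvd_of_dvd_mul_right this))
      have h2 : (1 : ℝ) ≤ |(m : ℝ) * a - q * z| := by exact_mod_cast Int.one_le_abs hne
      have h3 : (m : ℝ) * a / q - z = (m * a - q * z) / q := by field_simp
      rw [h3, abs_div, abs_of_pos hq0]
      gcongr
    have hclose : |(m : ℝ) * (s - a / q)| ≤ 1 / (2 * q) := by
      rw [abs_mul, Nat.abs_cast]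
      calc (m : ℝ) * |s - a / q| ≤ 2 * N * (1 / (4 * N * q)) := by gcongr
        _ = 1 / (2 * q) := by field_simp; norm_num
    have htri := distInt_le_add ((m : ℝ) * a / q) (m * (s - a / q))
    rw [show (m : ℝ) * a / q + m * (s - a / q) = m * s by ring] at htri
    have hhalf : 1 / (2 * (q : ℝ)) = 1 / q / 2 := by field_simp
    have hpos : 0 < 1 / (q : ℝ) := by positivity
    have hD : distInt ((m : ℝ) * a / q) / 2 ≤ distInt (m * s) := by linarith
    have hDpos : 0 < distInt ((m : ℝ) * a / q) := by linarith
    have hDs : 0 < distInt (m * s) := by linarith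
    have h5 : W m ≤ (distInt (m * s))⁻¹ := by
      rw [← one_div, le_div_iff₀ hDs, mul_comm]
      exact hW m
    refine h5.trans ((inv_anti₀ (by linarith) hD).trans (le_of_eq ?_))
    rw [inv_div, div_eq_mul_inv]
  have hsub : (Finset.Icc 1 (2 * N)).filter (fun m => ¬ q ∣ m) ⊆ Finset.range (q * P) := by
    intro m hm
    have := (Finset.mem_Icc.1 (Finset.mem_filter.1 hm).1).2
    have h6 := Nat.lt_mul_div_succ (2 * N) hq
    exact Finset.mem_range.2 (by rw [hP]; omega)
  have hqP : (q : ℝ) * P ≤ 6 * N := by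
    have : q * P ≤ 2 * N + q := by
      rw [hP, mul_add, mul_one]
      have := Nat.mul_div_le (2 * N) q
      omega
    exact_mod_cast (show q * P ≤ 6 * N by omega)
  have hlog : Real.log q ≤ Real.log (4 * N) := Real.log_le_log hq0 hqN'
  have hlog0 : 0 ≤ Real.log q := Real.log_natCast_nonneg q
  calc ∑ m ∈ Finset.Icc 1 (2 * N) with ¬ q ∣ m, W m
      ≤ ∑ m ∈ Finset.Icc 1 (2 * N) with ¬ q ∣ m, 2 * (distInt ((m : ℝ) * a / q))⁻¹ :=
        Finset.sum_le_sum h1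
    _ ≤ ∑ m ∈ Finset.range (q * P), 2 * (distInt ((m : ℝ) * a / q))⁻¹ :=
        Finset.sum_le_sum_of_subset_of_nonneg hsub fun m _ _ =>
          mul_nonneg zero_le_two (inv_nonneg.2 (distInt_nonneg _))
    _ ≤ 2 * (P * (2 * q * (1 + Real.log q))) := by
        rw [← Finset.mul_sum]
        gcongr
        exact sum_range_inv_distInt_mul_div_le q P hq a ha
    _ = 4 * (q * P) * (1 + Real.log q) := by ring
    _ ≤ 4 * (6 * N) * (1 + Real.log (4 * N)) := by gcongr
    _ = _ := by ring

lemma sum_dvd_eq {N q : ℕ} (hq : 0 < q) (W : ℕ → ℝ) :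
    ∑ m ∈ Finset.Icc 1 (2 * N) with q ∣ m, W m =
      ∑ i ∈ Finset.range (2 * N / q), W (q * (i + 1)) := by
  symm
  refine Finset.sum_bij (fun i _ => q * (i + 1)) ?_ ?_ ?_ ?_
  · intro i hi
    have hi' : i + 1 ≤ 2 * N / q := Finset.mem_range.1 hi
    refine Finset.mem_filter.2 ⟨Finset.mem_Icc.2 ⟨Nat.mul_pos hq i.succ_pos, ?_⟩, dvd_mul_right _ _⟩
    exact (Nat.mul_le_mul_left q hi').trans (Nat.mul_div_le _ _)
  · intro i _ j _ h
    have := Nat.eq_of_mul_eq_mul_left hq h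
    omega
  · intro m hm
    obtain ⟨hm1, k, rfl⟩ := Finset.mem_filter.1 hm
    obtain ⟨hm1, hm2⟩ := Finset.mem_Icc.1 hm1
    have hk : 0 < k := Nat.pos_of_ne_zero (by rintro rfl; simp at hm1)
    refine ⟨k - 1, Finset.mem_range.2 ?_, by rw [Nat.sub_add_cancel hk]⟩
    have : k ≤ 2 * N / q := (Nat.le_div_iff_mul_le hq).2 (by linarith)
    omega
  · intro i _
    rfl

lemma sum_dvd_le {N q : ℕ} (hq : 0 < q) (W : ℕ → ℝ) (hW : ∀ m, W m ≤ N) :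
    q * ∑ m ∈ Finset.Icc 1 (2 * N) with q ∣ m, W m ≤ 2 * (N : ℝ) ^ 2 := by
  rw [sum_dvd_eq hq]
  have h1 : ∑ i ∈ Finset.range (2 * N / q), W (q * (i + 1)) ≤ ((2 * N / q : ℕ) : ℝ) * N := by
    refine (Finset.sum_le_card_nsmul _ _ _ fun i _ => hW _).trans (le_of_eq ?_)
    rw [Finset.card_range, nsmul_eq_mul]
  have h2 : (q : ℝ) * ((2 * N / q : ℕ) : ℝ) ≤ 2 * N := by
    exact_mod_cast Nat.mul_div_le (2 * N) q
  have h3 : (0 : ℝ) ≤ q := Nat.cast_nonneg q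
  have h4 : (0 : ℝ) ≤ N := Nat.cast_nonneg N
  nlinarith [mul_le_mul_of_nonneg_left h1 h3, mul_le_mul_of_nonneg_right h2 h4]

lemma mul_sum_dvd_le {N q : ℕ} (hN : 0 < N) (hq : 0 < q) {a : ℤ} {s : ℝ}
    (hs : |s - a / q| ≤ 1 / (4 * N * q)) (W : ℕ → ℝ) (hW0 : ∀ m, 0 ≤ W m)
    (hW : ∀ m : ℕ, distInt (m * s) * W m ≤ 1) :
    q * |s - a / q| * ∑ m ∈ Finset.Icc 1 (2 * N) with q ∣ m, W m ≤ 1 + Real.log (4 * N) := by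
  have hq0 : (0 : ℝ) < q := by exact_mod_cast hq
  have hN0 : (0 : ℝ) < N := by exact_mod_cast hN
  have hq1 : (1 : ℝ) ≤ q := by exact_mod_cast hq
  rw [sum_dvd_eq hq, Finset.mul_sum]
  have h1 : ∀ i ∈ Finset.range (2 * N / q), q * |s - a / q| * W (q * (i + 1)) ≤ ((i : ℝ) + 1)⁻¹ := by
    intro i hi
    have hi' : q * (i + 1) ≤ 2 * N :=
      (Nat.mul_le_mul_left q (Finset.mem_range.1 hi)).trans (Nat.mul_div_le _ _)
    have hi'' : (q : ℝ) * (i + 1) ≤ 2 * N := by exact_mod_cast hi'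
    have habs : |(q * (i + 1) : ℝ) * (s - a / q)| = (i + 1) * (q * |s - a / q|) := by
      rw [abs_mul, abs_of_nonneg (by positivity)]
      ring
    have hsmall : |(q * (i + 1) : ℝ) * (s - a / q)| ≤ 1 / 2 := by
      rw [abs_mul, abs_of_nonneg (by positivity)]
      calc (q * (i + 1) : ℝ) * |s - a / q| ≤ 2 * N * (1 / (4 * N * q)) := by gcongr
        _ = 1 / 2 * (1 / q) := by field_simp; norm_num
        _ ≤ 1 / 2 * 1 := by
            gcongr
            rw [div_le_one hq0]
            exact hq1
        _ = 1 / 2 := mul_one _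
    have hdist := abs_le_distInt hsmall
    have hper : distInt (((q * (i + 1) : ℕ) : ℝ) * s) =
        distInt ((q * (i + 1) : ℝ) * (s - a / q)) := by
      rw [← distInt_add_intCast ((q * (i + 1) : ℝ) * (s - a / q)) ((i + 1) * a)]
      congr 1
      push_cast
      field_simp
      ring
    have hw := hW (q * (i + 1))
    rw [hper] at hw
    rw [habs] at hdist
    rw [← one_div, le_div_iff₀ (by positivity)]
    calc q * |s - a / q| * W (q * (i + 1)) * ((i : ℝ) + 1)
        = (i + 1) * (q * |s - a / q|) * W (q * (i + 1)) := by ring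
      _ ≤ _ := (mul_le_mul_of_nonneg_right hdist (hW0 _)).trans hw
  refine (Finset.sum_le_sum h1).trans ((sum_range_inv_succ_le _).trans (add_le_add le_rfl ?_))
  rcases Nat.eq_zero_or_pos (2 * N / q) with h0 | h0
  · rw [h0, Nat.cast_zero, Real.log_zero]
    refine Real.log_nonneg ?_
    have : (1 : ℝ) ≤ N := by exact_mod_cast hN
    linarith
  · refine Real.log_le_log (by exact_mod_cast h0) ?_
    exact_mod_cast (Nat.div_le_self (2 * N) q).trans (by omega)

/-- Weyl's inequality near a rational number, with its decay away from that number. -/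
lemma norm_gaussSumG_sq_le_of_approx {N q : ℕ} (hN : 0 < N) (hq : 0 < q) (hqN : q ≤ 4 * N) {a : ℤ}
    (ha : IsCoprime (q : ℤ) a) {s : ℝ} (hs : |s - a / q| ≤ 1 / (4 * N * q)) (g : ℤ) (r u : ℝ)
    (hu : ⌊u⌋₊ + 1 ≤ N) :
    q * ‖gaussSumG g s r u‖ ^ 2 ≤ 200 * (1 + Real.log (4 * N)) * N ^ 2 ∧
      q * |s - a / q| * ‖gaussSumG g s r u‖ ^ 2 ≤ 200 * (1 + Real.log (4 * N)) := by
  have hq0 : (0 : ℝ) < q := by exact_mod_cast hq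
  have hN0 : (0 : ℝ) < N := by exact_mod_cast hN
  have hN1 : (1 : ℝ) ≤ N := by exact_mod_cast hN
  have hqN' : (q : ℝ) ≤ 4 * N := by exact_mod_cast hqN
  set M := ⌊u⌋₊ + 1 with hM
  set W : ℕ → ℝ := fun m => ‖∑ k ∈ Finset.range (M - m / 2), efun (k * (m * s))‖ with hWdef
  have hW0 : ∀ m, 0 ≤ W m := fun m => norm_nonneg _
  have hW1 : ∀ m, W m ≤ N := by
    intro m
    refine (norm_sum_le _ _).trans ?_
    simp only [norm_efun, Finset.sum_const, Finset.card_range, nsmul_eq_mul, mul_one]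
    exact_mod_cast (Nat.sub_le _ _).trans hu
  have hW2 : ∀ m : ℕ, distInt (m * s) * W m ≤ 1 := fun m => distInt_mul_norm_geom_sum_le _ _
  have hsum : ‖gaussSumG g s r u‖ ^ 2 ≤ N + 2 * ∑ m ∈ Finset.Icc 1 (2 * N), W m := by
    refine (norm_gaussSumG_sq_le g s r u).trans ?_
    gcongr
    rw [← hM]
    have h1 : ∑ h ∈ Finset.range M,
        ‖∑ k ∈ Finset.range (M - (h + 1)), efun (k * ((2 * (h + 1) : ℕ) * s))‖ =
        ∑ m ∈ (Finset.range M).image (fun h => 2 * (h + 1)), W m := by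
      rw [Finset.sum_image (fun x _ y _ h => by simpa using h)]
      refine Finset.sum_congr rfl fun h _ => ?_
      simp only [hWdef, Nat.mul_div_cancel_left (h + 1) two_pos]
    rw [h1]
    refine Finset.sum_le_sum_of_subset_of_nonneg ?_ fun m _ _ => hW0 m
    intro m hm
    obtain ⟨h, hh, rfl⟩ := Finset.mem_image.1 hm
    have := Finset.mem_range.1 hh
    exact Finset.mem_Icc.2 ⟨by omega, by omega⟩
  rw [← Finset.sum_filter_add_sum_filter_not _ (fun m => q ∣ m)] at hsum
  have hA := sum_not_dvd_le hN hq hqN ha hs W hW2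
  have hB := sum_dvd_le hq W hW1
  have hB' := mul_sum_dvd_le hN hq hs W hW0 hW2
  set A := ∑ m ∈ Finset.Icc 1 (2 * N) with ¬ q ∣ m, W m
  set B := ∑ m ∈ Finset.Icc 1 (2 * N) with q ∣ m, W m
  have hℓ : (1 : ℝ) ≤ 1 + Real.log (4 * N) := by
    have := Real.log_nonneg (x := 4 * (N : ℝ)) (by linarith)
    linarith
  set ℓ := 1 + Real.log (4 * N)
  have hX : ‖gaussSumG g s r u‖ ^ 2 ≤ 49 * N * ℓ + 2 * B := by nlinarith
  refine ⟨?_, ?_⟩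
  · calc q * ‖gaussSumG g s r u‖ ^ 2 ≤ q * (49 * N * ℓ + 2 * B) := by gcongr
      _ = q * (49 * N * ℓ) + 2 * (q * B) := by ring
      _ ≤ 4 * N * (49 * N * ℓ) + 2 * (2 * (N : ℝ) ^ 2) := by gcongr
      _ ≤ _ := by nlinarith [sq_nonneg (N : ℝ)]
  · have hqs : q * |s - a / q| * N ≤ 1 / 4 := by
      calc q * |s - a / q| * N ≤ q * (1 / (4 * N * q)) * N := by gcongr
        _ = 1 / 4 := by field_simp
    calc q * |s - a / q| * ‖gaussSumG g s r u‖ ^ 2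
        ≤ q * |s - a / q| * (49 * N * ℓ + 2 * B) := by gcongr
      _ = 49 * ℓ * (q * |s - a / q| * N) + 2 * (q * |s - a / q| * B) := by ring
      _ ≤ 49 * ℓ * (1 / 4) + 2 * ℓ := by gcongr
      _ ≤ _ := by linarith

/-- The Lorentzian of height one and inverse width `c` centred at `t`. -/
def lorentzian (c t s : ℝ) : ℝ := (1 + (c * (s - t)) ^ 2)⁻¹

lemma lorentzian_nonneg (c t s : ℝ) : 0 ≤ lorentzian c t s := by
  unfold lorentzian
  positivity

lemma integrable_lorentzian {c : ℝ} (hc : 0 < c) (t : ℝ) : Integrable (lorentzian c t) :=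
  (integrable_inv_one_add_sq.comp_mul_left' hc.ne').comp_sub_right t

lemma integral_lorentzian {c : ℝ} (hc : 0 < c) (t : ℝ) : ∫ s, lorentzian c t s = Real.pi / c := by
  unfold lorentzian
  rw [integral_sub_right_eq_self (fun s => (1 + (c * s) ^ 2)⁻¹) t,
    Measure.integral_comp_mul_left (fun s => (1 + s ^ 2)⁻¹) c, integral_univ_inv_one_add_sq,
    abs_of_pos (inv_pos.2 hc), smul_eq_mul]
  ring

/-- The nonzero numerators `a` with `|a / q| ≤ 2 * S`. -/
def numerators (S : ℝ) (q : ℕ) : Finset ℤ := (Finset.Icc (-⌊2 * q * S⌋) ⌊2 * q * S⌋).erase 0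

lemma card_numerators_le {S : ℝ} (hS : 0 ≤ S) (q : ℕ) :
    ((numerators S q).card : ℝ) ≤ 4 * q * S := by
  unfold numerators
  have h0 : 0 ≤ ⌊2 * q * S⌋ := Int.floor_nonneg.2 (by positivity)
  rw [Finset.card_erase_of_mem (Finset.mem_Icc.2 ⟨by linarith, h0⟩), Int.card_Icc]
  have h1 : (((⌊2 * q * S⌋ + 1 - -⌊2 * q * S⌋).toNat - 1 : ℕ) : ℤ) = 2 * ⌊2 * q * S⌋ := by omega
  have h2 : (((⌊2 * q * S⌋ + 1 - -⌊2 * q * S⌋).toNat - 1 : ℕ) : ℝ) = 2 * (⌊2 * q * S⌋ : ℝ) := by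
    exact_mod_cast h1
  rw [h2]
  have := Int.floor_le (2 * q * S)
  linarith

/-- A sum of Lorentzians over the Farey fractions of height at most `2 * S`, which majorizes the
fourth power of the Gauss sum up to logarithms. -/
def fareyMajorant (N : ℕ) (L S s : ℝ) : ℝ :=
  L ^ 2 * lorentzian L 0 s +
    ∑ i ∈ Finset.range (4 * N), ∑ a ∈ numerators S (i + 1),
      (N : ℝ) ^ 4 / ((i : ℝ) + 1) ^ 2 * lorentzian ((N : ℝ) ^ 2) (a / ((i : ℝ) + 1)) s

lemma fareyMajorant_nonneg (N : ℕ) (L S s : ℝ) : 0 ≤ fareyMajorant N L S s := by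
  unfold fareyMajorant
  refine add_nonneg (mul_nonneg (sq_nonneg _) (lorentzian_nonneg _ _ _)) ?_
  exact Finset.sum_nonneg fun i _ => Finset.sum_nonneg fun a _ =>
    mul_nonneg (by positivity) (lorentzian_nonneg _ _ _)

lemma integrable_fareyMajorant {N : ℕ} (hN : 0 < N) {L : ℝ} (hL : 0 < L) (S : ℝ) :
    Integrable (fareyMajorant N L S) := by
  have hN0 : (0 : ℝ) < N := by exact_mod_cast hN
  refine ((integrable_lorentzian hL 0).const_mul _).add ?_
  exact integrable_finsetSum _ fun i _ => integrable_finsetSum _ fun a _ =>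
    (integrable_lorentzian (by positivity) _).const_mul _

lemma integral_fareyMajorant_le {N : ℕ} (hN : 0 < N) {L S : ℝ} (hL : 0 < L) (hS : 0 ≤ S) :
    ∫ s, fareyMajorant N L S s ≤
      Real.pi * (L + 4 * S * (N : ℝ) ^ 2 * (1 + Real.log (4 * N))) := by
  have hN0 : (0 : ℝ) < N := by exact_mod_cast hN
  have hint : ∀ (i : ℕ) (a : ℤ), Integrable fun s =>
      (N : ℝ) ^ 4 / ((i : ℝ) + 1) ^ 2 * lorentzian ((N : ℝ) ^ 2) (a / ((i : ℝ) + 1)) s :=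
    fun i a => (integrable_lorentzian (by positivity) _).const_mul _
  unfold fareyMajorant
  rw [integral_add ((integrable_lorentzian hL 0).const_mul _)
    (integrable_finsetSum _ fun i _ => integrable_finsetSum _ fun a _ => hint i a),
    integral_const_mul, integral_lorentzian hL,
    integral_finsetSum _ fun i _ => integrable_finsetSum _ fun a _ => hint i a]
  have h1 : ∀ i ∈ Finset.range (4 * N), (∫ s, ∑ a ∈ numerators S (i + 1),
      (N : ℝ) ^ 4 / ((i : ℝ) + 1) ^ 2 * lorentzian ((N : ℝ) ^ 2) (a / ((i : ℝ) + 1)) s) ≤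
      Real.pi * (4 * S * (N : ℝ) ^ 2) * ((i : ℝ) + 1)⁻¹ := by
    intro i _
    rw [integral_finsetSum _ fun a _ => hint i a]
    simp only [integral_const_mul, integral_lorentzian (pow_pos hN0 2), Finset.sum_const,
      nsmul_eq_mul]
    calc ((numerators S (i + 1)).card : ℝ) *
          ((N : ℝ) ^ 4 / ((i : ℝ) + 1) ^ 2 * (Real.pi / (N : ℝ) ^ 2))
        ≤ 4 * ((i + 1 : ℕ) : ℝ) * S *
          ((N : ℝ) ^ 4 / ((i : ℝ) + 1) ^ 2 * (Real.pi / (N : ℝ) ^ 2)) := by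
          refine mul_le_mul_of_nonneg_right (card_numerators_le hS _) ?_
          have := Real.pi_pos
          positivity
      _ = _ := by
          push_cast
          field_simp
  have h2 := Finset.sum_le_sum h1
  rw [← Finset.mul_sum] at h2
  have h3 := sum_range_inv_succ_le (4 * N)
  push_cast at h3
  have hpi := Real.pi_pos
  have h4 : L ^ 2 * (Real.pi / L) = Real.pi * L := by field_simp
  have h5 := mul_le_mul_of_nonneg_left h3
    (show 0 ≤ Real.pi * (4 * S * (N : ℝ) ^ 2) by positivity)
  rw [h4]
  linarith

/-- Pointwise bounds for the Gauss sum at frequencies `L⁻¹ ≤ |s| ≤ S`. -/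
lemma norm_gaussSumG_sq_bounds {N : ℕ} (hN : 0 < N) {L S : ℝ} (hL : 0 < L) (hLN : L ≤ N)
    (hLS : L⁻¹ ≤ S) {s : ℝ} (hs1 : L⁻¹ ≤ |s|) (hs2 : |s| ≤ S) (g : ℤ) (r u : ℝ)
    (hu : ⌊u⌋₊ + 1 ≤ N) :
    ‖gaussSumG g s r u‖ ^ 2 ≤ 400 * (1 + Real.log (4 * N)) * (N ^ 2 * S) ∧
      (‖gaussSumG g s r u‖ ^ 2) ^ 2 ≤
        2 * (200 * (1 + Real.log (4 * N))) ^ 2 * fareyMajorant N L S s := by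
  have hN0 : (0 : ℝ) < N := by exact_mod_cast hN
  have hN1 : (1 : ℝ) ≤ N := by exact_mod_cast hN
  have hS : 0 < S := (inv_pos.2 hL).trans_le hLS
  have hℓ : (1 : ℝ) ≤ 1 + Real.log (4 * N) := by
    have := Real.log_nonneg (x := 4 * (N : ℝ)) (by linarith)
    linarith
  obtain ⟨ρ, hρ, hden⟩ := Real.exists_rat_abs_sub_le_and_den_le s (n := 4 * N) (by omega)
  have hq : 0 < ρ.den := ρ.den_pos
  have hq0 : (0 : ℝ) < ρ.den := by exact_mod_cast hq
  have hq1 : (1 : ℝ) ≤ ρ.den := by exact_mod_cast hq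
  have hcop : IsCoprime (ρ.den : ℤ) ρ.num := by
    rw [Int.isCoprime_iff_gcd_eq_one, Int.gcd_comm]
    exact ρ.reduced
  have happ : |s - ρ.num / ρ.den| ≤ 1 / (4 * N * ρ.den) := by
    rw [Rat.cast_def] at hρ
    refine hρ.trans ?_
    push_cast
    gcongr
    linarith
  obtain ⟨hX1, hX2⟩ := norm_gaussSumG_sq_le_of_approx hN hq hden hcop happ g r u hu
  have hX0 : 0 ≤ ‖gaussSumG g s r u‖ ^ 2 := sq_nonneg _
  set X := ‖gaussSumG g s r u‖ ^ 2
  set ℓ := 1 + Real.log (4 * N)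
  have hlor : ∀ c t : ℝ, 0 < 1 + (c * (s - t)) ^ 2 := fun c t => by positivity
  by_cases h0 : ρ.num = 0
  · have hρ0 : ρ = 0 := Rat.num_eq_zero.1 h0
    subst hρ0
    simp only [Rat.num_zero, Rat.den_zero, Int.cast_zero, Nat.cast_one, zero_div, sub_zero,
      one_mul] at hX2
    have hsL : 1 ≤ L * |s| := by
      have := mul_le_mul_of_nonneg_left hs1 hL.le
      rwa [mul_inv_cancel₀ hL.ne'] at this
    have hXL : X ≤ 200 * ℓ * L := by nlinarith
    have hLS' : L ≤ N ^ 2 * S := by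
      calc L = L ^ 2 * L⁻¹ := by field_simp
        _ ≤ N ^ 2 * S := by gcongr
    refine ⟨by nlinarith, ?_⟩
    have hmain : X ^ 2 ≤ 2 * (200 * ℓ) ^ 2 * (L ^ 2 * lorentzian L 0 s) := by
      unfold lorentzian
      rw [← mul_assoc, ← div_eq_mul_inv, le_div_iff₀ (hlor L 0), sub_zero]
      have h1 : (|s| * X) ^ 2 ≤ (200 * ℓ) ^ 2 := by gcongr
      have h2 : 1 ≤ (L * s) ^ 2 := by
        rw [← sq_abs, abs_mul, abs_of_pos hL]
        nlinarith
      rw [mul_pow, sq_abs] at h1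
      have h3 := mul_le_mul_of_nonneg_left h1 (sq_nonneg L)
      have h4 := mul_le_mul_of_nonneg_left h2 (sq_nonneg X)
      nlinarith
    refine hmain.trans (mul_le_mul_of_nonneg_left ?_ (by positivity))
    unfold fareyMajorant
    refine le_add_of_nonneg_right ?_
    exact Finset.sum_nonneg fun i _ => Finset.sum_nonneg fun a _ =>
      mul_nonneg (by positivity) (lorentzian_nonneg _ _ _)
  · have ha1 : (1 : ℝ) ≤ |(ρ.num : ℝ)| := by exact_mod_cast Int.one_le_abs h0
    have ha2 : |(ρ.num : ℝ)| ≤ ρ.den * S + 1 / 4 := by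
      have h1 : |(ρ.num : ℝ) / ρ.den| ≤ S + 1 / (4 * N * ρ.den) := by
        have h2 := abs_sub_abs_le_abs_sub ((ρ.num : ℝ) / ρ.den) s
        rw [abs_sub_comm] at h2
        linarith
      rw [abs_div, abs_of_pos hq0, div_le_iff₀ hq0] at h1
      refine h1.trans ?_
      have h3 : (S + 1 / (4 * N * ρ.den)) * ρ.den = ρ.den * S + 1 / 4 * (1 / N) := by
        field_simp
      have h4 : 1 / (N : ℝ) ≤ 1 := by
        rw [div_le_one hN0]
        exact hN1
      rw [h3]
      linarith
    have hmem : ρ.num ∈ numerators S ρ.den := by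
      have h1 : |(ρ.num : ℝ)| ≤ 2 * ρ.den * S := by linarith
      obtain ⟨h2, h3⟩ := abs_le.1 h1
      refine Finset.mem_erase.2 ⟨h0, Finset.mem_Icc.2 ⟨?_, Int.le_floor.2 h3⟩⟩
      have : -ρ.num ≤ ⌊2 * (ρ.den : ℝ) * S⌋ := Int.le_floor.2 (by push_cast; linarith)
      linarith
    refine ⟨?_, ?_⟩
    · have h1 : 3 / 4 ≤ ρ.den * S := by linarith
      have h2 := mul_le_mul_of_nonneg_left h1 hX0
      have h3 := mul_le_mul_of_nonneg_right hX1 hS.le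
      have h4 : 0 ≤ ℓ * (N ^ 2 * S) := by positivity
      nlinarith
    have hmain : X ^ 2 ≤ 2 * (200 * ℓ) ^ 2 * ((N : ℝ) ^ 4 / (ρ.den : ℝ) ^ 2 *
        lorentzian ((N : ℝ) ^ 2) (ρ.num / (ρ.den : ℝ)) s) := by
      unfold lorentzian
      rw [← mul_assoc, ← div_eq_mul_inv, le_div_iff₀ (hlor _ _), ← mul_div_assoc,
        le_div_iff₀ (by positivity)]
      have h1 : (ρ.den * X) ^ 2 ≤ (200 * ℓ * N ^ 2) ^ 2 := by gcongr
      have h2 : (ρ.den * |s - ρ.num / ρ.den| * X) ^ 2 ≤ (200 * ℓ) ^ 2 := by gcongr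
      rw [mul_pow, mul_pow, sq_abs] at h2
      have h3 := mul_le_mul_of_nonneg_left h2 (show (0 : ℝ) ≤ N ^ 4 by positivity)
      linear_combination h1 + h3
    refine hmain.trans (mul_le_mul_of_nonneg_left ?_ (by positivity))
    unfold fareyMajorant
    refine le_add_of_nonneg_of_le (mul_nonneg (sq_nonneg _) (lorentzian_nonneg _ _ _)) ?_
    have hi : ((ρ.den - 1 : ℕ) : ℝ) + 1 = ρ.den := by
      exact_mod_cast Nat.sub_add_cancel hq
    have hterm : ∀ (i : ℕ) (a : ℤ), 0 ≤ (N : ℝ) ^ 4 / ((i : ℝ) + 1) ^ 2 *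
        lorentzian ((N : ℝ) ^ 2) (a / ((i : ℝ) + 1)) s := fun i a =>
      mul_nonneg (by positivity) (lorentzian_nonneg _ _ _)
    refine le_trans ?_ (Finset.single_le_sum
      (fun i _ => Finset.sum_nonneg fun a _ => hterm i a)
      (Finset.mem_range.2 (show ρ.den - 1 < 4 * N by omega)))
    rw [Nat.sub_add_cancel hq, hi]
    exact Finset.single_le_sum (f := fun a : ℤ => (N : ℝ) ^ 4 / (ρ.den : ℝ) ^ 2 *
      lorentzian ((N : ℝ) ^ 2) (a / (ρ.den : ℝ)) s)
      (fun a _ => mul_nonneg (by positivity) (lorentzian_nonneg _ _ _)) hmem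

/-- The moment bound with explicit logarithms. -/
lemma lintegral_gaussSumG_pow_le {d : ℕ} (hd : 2 ≤ d) {N : ℕ} (hN : 0 < N) {L S : ℝ} (hL : 0 < L)
    (hLN : L ≤ N) (hLS : L⁻¹ ≤ S) (g : ℤ) (r u : ℝ) (hu : ⌊u⌋₊ + 1 ≤ N) :
    (∫⁻ s in {s : ℝ | L⁻¹ ≤ |s| ∧ |s| ≤ S}, (‖gaussSumG g s r u‖₊ : ℝ≥0∞) ^ (2 * d)) ≤
      ENNReal.ofReal (40 * 400 ^ d * (1 + Real.log (4 * N)) ^ (d + 1) *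
        ((N : ℝ) ^ 2 * S) ^ (d - 1)) := by
  have hN0 : (0 : ℝ) < N := by exact_mod_cast hN
  have hN1 : (1 : ℝ) ≤ N := by exact_mod_cast hN
  have hS : 0 < S := (inv_pos.2 hL).trans_le hLS
  have hℓ : (1 : ℝ) ≤ 1 + Real.log (4 * N) := by
    have := Real.log_nonneg (x := 4 * (N : ℝ)) (by linarith)
    linarith
  have hLS' : L ≤ N ^ 2 * S := by
    calc L = L ^ 2 * L⁻¹ := by field_simp
      _ ≤ N ^ 2 * S := by gcongr
  have hI := integral_fareyMajorant_le hN hL hS.le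
  have hpt := fun s (hs : s ∈ {s : ℝ | L⁻¹ ≤ |s| ∧ |s| ≤ S}) =>
    norm_gaussSumG_sq_bounds hN hL hLN hLS hs.1 hs.2 g r u hu
  set ℓ := 1 + Real.log (4 * N)
  set Y := (N : ℝ) ^ 2 * S with hY
  have hY0 : 0 < Y := by positivity
  obtain ⟨e, rfl⟩ : ∃ e, d = e + 2 := ⟨d - 2, by omega⟩
  set c := (400 * ℓ * Y) ^ e * (2 * (200 * ℓ) ^ 2) with hc
  have hc0 : 0 ≤ c := by positivity
  have hmeas : MeasurableSet {s : ℝ | L⁻¹ ≤ |s| ∧ |s| ≤ S} :=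
    (measurableSet_le measurable_const measurable_norm).inter
      (measurableSet_le measurable_norm measurable_const)
  calc (∫⁻ s in {s : ℝ | L⁻¹ ≤ |s| ∧ |s| ≤ S}, (‖gaussSumG g s r u‖₊ : ℝ≥0∞) ^ (2 * (e + 2)))
      ≤ ∫⁻ s in {s : ℝ | L⁻¹ ≤ |s| ∧ |s| ≤ S}, ENNReal.ofReal (c * fareyMajorant N L S s) := by
        refine setLIntegral_mono' hmeas fun s hs => ?_
        obtain ⟨h1, h2⟩ := hpt s hs
        have h3 : (‖gaussSumG g s r u‖₊ : ℝ≥0∞) = ENNReal.ofReal ‖gaussSumG g s r u‖ :=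
          (ofReal_norm _).symm
        rw [h3, ← ENNReal.ofReal_pow (norm_nonneg _)]
        refine ENNReal.ofReal_le_ofReal ?_
        rw [pow_mul, pow_add, hc, mul_assoc]
        gcongr
    _ ≤ ∫⁻ s, ENNReal.ofReal (c * fareyMajorant N L S s) := setLIntegral_le_lintegral _ _
    _ = ENNReal.ofReal (∫ s, c * fareyMajorant N L S s) :=
        (ofReal_integral_eq_lintegral_ofReal ((integrable_fareyMajorant hN hL S).const_mul c)
          (Filter.Eventually.of_forall fun s => mul_nonneg hc0 (fareyMajorant_nonneg N L S s))).symm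
    _ ≤ _ := by
        refine ENNReal.ofReal_le_ofReal ?_
        rw [integral_const_mul]
        have h1 : ∫ s, fareyMajorant N L S s ≤ 20 * (ℓ * Y) := by
          refine hI.trans ?_
          have h2 : L + 4 * S * (N : ℝ) ^ 2 * ℓ ≤ 5 * (ℓ * Y) := by
            have : Y ≤ ℓ * Y := le_mul_of_one_le_left hY0.le hℓ
            rw [hY] at this hLS' ⊢
            linarith
          calc Real.pi * (L + 4 * S * (N : ℝ) ^ 2 * ℓ) ≤ 4 * (5 * (ℓ * Y)) := by
                gcongr
                exact Real.pi_le_four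
            _ = _ := by ring
        calc c * ∫ s, fareyMajorant N L S s ≤ c * (20 * (ℓ * Y)) := by gcongr
          _ = 10 * 400 ^ (e + 2) * ℓ ^ (e + 2 + 1) * Y ^ (e + 1) := by
              rw [hc]
              simp only [mul_pow, pow_succ]
              ring
          _ ≤ 40 * 400 ^ (e + 2) * ℓ ^ (e + 2 + 1) * Y ^ (e + 2 - 1) := by
              rw [show e + 2 - 1 = e + 1 by omega]
              gcongr
              norm_num

lemma one_add_log_le_mul_log {lam L : ℝ} {N : ℕ} (hL : 3 ≤ L) (hlam : 1 ≤ lam)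
    (hlam' : lam ≤ Real.log L ^ 4) (hN : 0 < N) (hNL : (N : ℝ) ≤ 2 * (lam * L)) :
    1 + Real.log (4 * N) ≤ 13 * Real.log L := by
  have hL0 : 0 < L := by linarith
  have hN0 : (0 : ℝ) < N := by exact_mod_cast hN
  have hlam0 : 0 < lam := by linarith
  have h1 : 1 ≤ Real.log L := by
    rw [Real.le_log_iff_exp_le hL0]
    have := Real.exp_one_lt_d9
    linarith
  have h2 : Real.log (4 * N) ≤ Real.log (8 * lam * L) :=
    Real.log_le_log (by positivity) (by linarith)
  rw [Real.log_mul (by positivity) hL0.ne', Real.log_mul (by norm_num) hlam0.ne'] at h2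
  have h3 : Real.log 8 ≤ 7 := by
    have := Real.log_le_sub_one_of_pos (x := 8) (by norm_num)
    linarith
  have h4 : Real.log lam ≤ 4 * Real.log (Real.log L) := by
    refine (Real.log_le_log hlam0 hlam').trans (le_of_eq ?_)
    rw [Real.log_pow]
    norm_num
  have h5 := Real.log_le_sub_one_of_pos (x := Real.log L) (by linarith)
  linarith

theorem statement16 (d : ℕ) (hd : 3 ≤ d) (γ : ℝ) (hγ : 1 / 2 ≤ γ) (hγ' : γ < 1) :
    ∃ η₀ : ℝ, 0 < η₀ ∧ ∀ η : ℝ, 0 < η → η ≤ η₀ →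
    ∃ C : ℝ, 1 ≤ C ∧
    ∀ L : ℝ, C ≤ L →
    ∀ lam : ℝ, 1 ≤ lam → lam ≤ Real.log L ^ 4 →
    ∀ (g : ℤ) (ξ u : ℝ), 0 < u → u ≤ lam * L →
      (∫⁻ s in {s : ℝ | L⁻¹ ≤ |s| ∧ |s| ≤ L ^ (2 * γ - 2 + η / (10 * (d : ℝ)))},
          (‖gaussSumG g s ξ u‖₊ : ℝ≥0∞) ^ (2 * d))
        ≤ ENNReal.ofReal (C * lam ^ (2 * (d : ℝ)) * L ^ (2 * (d : ℝ) - 2) *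
            L ^ (-((d : ℝ) - 1) * (2 - 2 * γ) + η)) := by
  refine ⟨1, one_pos, fun η hη _ => ?_⟩
  have hd0 : (3 : ℝ) ≤ d := by exact_mod_cast hd
  set ε := η / (2 * ((d : ℝ) + 1)) with hε
  have hε0 : 0 < ε := by positivity
  set K : ℝ := 40 * 400 ^ d * (13 / ε) ^ (d + 1) * 4 ^ (d - 1) with hK
  have hK0 : 0 ≤ K := by positivity
  refine ⟨max 3 K, le_max_of_le_left (by norm_num), fun L hCL lam hlam hlam' g ξ u _ huL => ?_⟩
  have hL3 : 3 ≤ L := (le_max_left _ _).trans hCL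
  have hL0 : 0 < L := by linarith
  have hL1 : 1 ≤ L := by linarith
  set S := L ^ (2 * γ - 2 + η / (10 * (d : ℝ))) with hS
  have hLS : L⁻¹ ≤ S := by
    rw [← Real.rpow_neg_one]
    refine Real.rpow_le_rpow_of_exponent_le hL1 ?_
    have : 0 < η / (10 * (d : ℝ)) := by positivity
    linarith
  have hS0 : 0 < S := Real.rpow_pos_of_pos hL0 _
  have hlamL : L ≤ lam * L := le_mul_of_one_le_left hL0.le hlam
  set N := ⌊lam * L⌋₊ + 1 with hN
  have hNpos : 0 < N := Nat.succ_pos _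
  have hNlow : lam * L ≤ N := by
    rw [hN]
    push_cast
    exact (Nat.lt_floor_add_one _).le
  have hNup : (N : ℝ) ≤ 2 * (lam * L) := by
    have := Nat.floor_le (show 0 ≤ lam * L by linarith)
    rw [hN]
    push_cast
    linarith
  refine (lintegral_gaussSumG_pow_le (by omega) hNpos hL0 (hlamL.trans hNlow) hLS g ξ u
    (Nat.succ_le_succ (Nat.floor_le_floor huL))).trans (ENNReal.ofReal_le_ofReal ?_)
  have hℓ0 : 0 ≤ 1 + Real.log (4 * N) := by
    have : (1 : ℝ) ≤ N := by exact_mod_cast hNpos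
    have := Real.log_nonneg (x := 4 * (N : ℝ)) (by linarith)
    linarith
  have hlog : (1 + Real.log (4 * N)) ^ (d + 1) ≤ (13 / ε) ^ (d + 1) * L ^ (η / 2) := by
    have h1 : 1 + Real.log (4 * N) ≤ 13 / ε * L ^ ε := by
      refine (one_add_log_le_mul_log hL3 hlam hlam' hNpos hNup).trans ?_
      calc 13 * Real.log L ≤ 13 * (L ^ ε / ε) := by
            gcongr
            exact Real.log_le_rpow_div hL0.le hε0
        _ = _ := by ring
    refine (pow_le_pow_left₀ hℓ0 h1 _).trans (le_of_eq ?_)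
    rw [mul_pow, ← Real.rpow_mul_natCast hL0.le]
    congr 2
    rw [hε]
    push_cast
    field_simp
  have hcast : ((d - 1 : ℕ) : ℝ) = (d : ℝ) - 1 := by
    rw [Nat.cast_sub (by omega), Nat.cast_one]
  have hpow : ((N : ℝ) ^ 2 * S) ^ (d - 1) ≤
      4 ^ (d - 1) * lam ^ (2 * (d : ℝ)) * L ^ (2 * (d : ℝ) - 2) *
        L ^ (((d : ℝ) - 1) * (2 * γ - 2) + η / 2) := by
    have h1 : (N : ℝ) ^ 2 * S ≤ 4 * lam ^ 2 * L ^ 2 * S := by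
      gcongr
      calc (N : ℝ) ^ 2 ≤ (2 * (lam * L)) ^ 2 := by gcongr
        _ = _ := by ring
    refine (pow_le_pow_left₀ (by positivity) h1 _).trans ?_
    rw [mul_pow, mul_pow, mul_pow]
    gcongr
    · rw [← Real.rpow_natCast, ← Real.rpow_natCast, ← Real.rpow_mul (by linarith), hcast]
      refine Real.rpow_le_rpow_of_exponent_le hlam ?_
      push_cast
      linarith
    · rw [← Real.rpow_natCast, ← Real.rpow_natCast, ← Real.rpow_mul hL0.le, hcast]
      refine Real.rpow_le_rpow_of_exponent_le hL1 (le_of_eq ?_)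
      push_cast
      ring
    · rw [hS, ← Real.rpow_natCast, ← Real.rpow_mul hL0.le, hcast]
      refine Real.rpow_le_rpow_of_exponent_le hL1 ?_
      have h2 : η / (10 * (d : ℝ)) * ((d : ℝ) - 1) ≤ η / 2 := by
        calc η / (10 * (d : ℝ)) * ((d : ℝ) - 1) ≤ η / (10 * (d : ℝ)) * d := by
              gcongr
              linarith
          _ = η / 10 := by field_simp
          _ ≤ η / 2 := by linarith
      linarith
  have hlam0 : 0 ≤ lam ^ (2 * (d : ℝ)) := Real.rpow_nonneg (by linarith) _
  calc 40 * 400 ^ d * (1 + Real.log (4 * N)) ^ (d + 1) * ((N : ℝ) ^ 2 * S) ^ (d - 1)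
      ≤ 40 * 400 ^ d * ((13 / ε) ^ (d + 1) * L ^ (η / 2)) *
        (4 ^ (d - 1) * lam ^ (2 * (d : ℝ)) * L ^ (2 * (d : ℝ) - 2) *
          L ^ (((d : ℝ) - 1) * (2 * γ - 2) + η / 2)) := by gcongr
    _ = K * lam ^ (2 * (d : ℝ)) * L ^ (2 * (d : ℝ) - 2) *
        (L ^ (η / 2) * L ^ (((d : ℝ) - 1) * (2 * γ - 2) + η / 2)) := by
        rw [hK]
        ring
    _ = K * lam ^ (2 * (d : ℝ)) * L ^ (2 * (d : ℝ) - 2) *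
        L ^ (-((d : ℝ) - 1) * (2 - 2 * γ) + η) := by
        rw [← Real.rpow_add hL0]
        congr 2
        ring
    _ ≤ _ := by
        gcongr
        exact le_max_right _ _
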